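/- For every integer j ≥ 1, the sequence of real numbers n ↦ (number of minimal factorizations F ∈ 𝔐_n with M_1(F) = j) / n^{n-2} converges, as n → ∞, to e^{-1} / (j-1)!. -/

import Mathlib

/-- `F` is a minimal factorization of size `n`, i.e. a factorization of the cycle
`(1,2,…,n)` (represented as `finRotate n` on `Fin n`, where the element `i ∈ {1,…,n}`
corresponds to the index `i-1 : Fin n`) into `n-1` transpositions: each `F k` is a
transposition and the left-to-right product `τ₁ τ₂ ⋯ τ_{n-1}` (apply `τ₁` first)
equals the cycle. -/
def IsMinFact (n : ℕ) (F : Fin (n - 1) → Equiv.Perm (Fin n)) : Prop :=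
  (∀ k, (F k).IsSwap) ∧ (List.ofFn F).reverse.prod = finRotate n

/-- `T(F, x)`: the number of transpositions in `F` moving the element represented by `x`. -/
def Tcount {n : ℕ} (F : Fin (n - 1) → Equiv.Perm (Fin n)) (x : Fin n) : ℕ :=
  (Finset.univ.filter fun k : Fin (n - 1) => F k x ≠ x).card

/-- `M(F, x)`: the number of indices `1 ≤ k ≤ n-1` with `τ₁⋯τ_{k-1}(x) ≠ τ₁⋯τ_k(x)`,
i.e. the number of transpositions affecting the trajectory of `x` (left-to-right
partial products, so `τ₁⋯τ_k` is the product of the first `k` entries, applied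
`τ₁` first). -/
def Mcount {n : ℕ} (F : Fin (n - 1) → Equiv.Perm (Fin n)) (x : Fin n) : ℕ :=
  (Finset.univ.filter fun k : Fin (n - 1) =>
    ((List.ofFn F).take k.val).reverse.prod x ≠
      ((List.ofFn F).take (k.val + 1)).reverse.prod x).card

section Orbits

open Finset Equiv Equiv.Perm

variable {n : ℕ}

/-- The orbit of `x` under `P`, as a finset. -/
def orbitFinset (P : Perm (Fin n)) (x : Fin n) : Finset (Fin n) :=
  univ.filter fun y => P.SameCycle x y

/-- The set of all orbits of `P`. -/
def orbitParts (P : Perm (Fin n)) : Finset (Finset (Fin n)) :=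
  univ.image (orbitFinset P)

theorem mem_orbitFinset {P : Perm (Fin n)} {x y : Fin n} :
    y ∈ orbitFinset P x ↔ P.SameCycle x y := by
  simp [orbitFinset]

theorem orbitFinset_eq_iff {P : Perm (Fin n)} {x y : Fin n} :
    orbitFinset P x = orbitFinset P y ↔ P.SameCycle x y := by
  constructor
  · intro h
    rw [← mem_orbitFinset, h, mem_orbitFinset]
  · intro h
    ext w
    simp only [mem_orbitFinset]
    exact ⟨fun hw => h.symm.trans hw, fun hw => h.trans hw⟩

theorem orbitFinset_mem_orbitParts (P : Perm (Fin n)) (x : Fin n) :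
    orbitFinset P x ∈ orbitParts P :=
  mem_image_of_mem _ (mem_univ x)

/-- A relation containing every step `x ↦ P x` contains `SameCycle`. -/
theorem sameCycle_imp_of_forall_apply {P : Perm (Fin n)} {r : Fin n → Fin n → Prop}
    (hr : Equivalence r) (h : ∀ x, r x (P x)) {x y : Fin n} (hxy : P.SameCycle x y) : r x y := by
  obtain ⟨i, rfl⟩ := hxy.exists_nat_pow_eq
  induction i with
  | zero => exact hr.refl x
  | succ k ih =>
    rw [pow_succ', Perm.mul_apply]
    exact hr.trans (ih ⟨k, by simp⟩) (h _)

theorem sameCycle_mul_swap_self {P : Perm (Fin n)} {a b : Fin n} (hab : ¬ P.SameCycle a b) :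
    (P * swap a b).SameCycle a b := by
  have key : ∀ i : ℕ, (P * swap a b).SameCycle a b ∨
      (P * swap a b).SameCycle a ((P ^ i) (P b)) := by
    intro i
    induction i with
    | zero => exact Or.inr ⟨1, by simp⟩
    | succ i ih =>
      rcases ih with ih | ih
      · exact Or.inl ih
      have hne : (P ^ i) (P b) ≠ a := fun h => hab (SameCycle.symm ⟨i + 1, by
        rw [← h]; exact_mod_cast congrArg (· b) (pow_succ P i)⟩)
      by_cases hb : (P ^ i) (P b) = b
      · exact Or.inl (by rwa [hb] at ih)
      · refine Or.inr ?_
        have : (P ^ (i + 1)) (P b) = (P * swap a b) ((P ^ i) (P b)) := by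
          rw [Perm.mul_apply, swap_apply_of_ne_of_ne hne hb, pow_succ', Perm.mul_apply]
        rwa [this, sameCycle_apply_right]
  obtain ⟨i, hi⟩ := (sameCycle_apply_left.2 (SameCycle.refl P b)).exists_nat_pow_eq
  simpa [hi] using key i

theorem sameCycle_mul_swap_of_not {P : Perm (Fin n)} {a b : Fin n} (hab : ¬ P.SameCycle a b)
    {x y : Fin n} (h : P.SameCycle x y) : (P * swap a b).SameCycle x y := by
  have hab' := sameCycle_mul_swap_self hab
  refine sameCycle_imp_of_forall_apply (SameCycle.equivalence _) (fun x => ?_) h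
  have hx : (P * swap a b).SameCycle (swap a b x) (P x) := ⟨1, by simp⟩
  refine SameCycle.trans ?_ hx
  rcases eq_or_ne x a with rfl | hxa
  · simpa using hab'
  rcases eq_or_ne x b with rfl | hxb
  · simpa using hab'.symm
  · rw [swap_apply_of_ne_of_ne hxa hxb]

theorem sameCycle_of_sameCycle_mul_swap {P : Perm (Fin n)} {a b : Fin n} (hab : P.SameCycle a b)
    {x y : Fin n} (h : (P * swap a b).SameCycle x y) : P.SameCycle x y := by
  refine sameCycle_imp_of_forall_apply (SameCycle.equivalence _) (fun x => ?_) h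
  rw [Perm.mul_apply, sameCycle_apply_right]
  rcases eq_or_ne x a with rfl | hxa
  · simpa using hab
  rcases eq_or_ne x b with rfl | hxb
  · simpa using hab.symm
  · rw [swap_apply_of_ne_of_ne hxa hxb]

theorem orbitFinset_mul_swap_left {P : Perm (Fin n)} {a b : Fin n} (hab : ¬ P.SameCycle a b) :
    orbitFinset (P * swap a b) a = orbitFinset P a ∪ orbitFinset P b := by
  have hab' := sameCycle_mul_swap_self hab
  ext y
  simp only [mem_union, mem_orbitFinset]
  constructor
  · intro h
    obtain ⟨i, rfl⟩ := h.exists_nat_pow_eq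
    clear h
    induction i with
    | zero => left; exact SameCycle.refl _ _
    | succ k ih =>
      rw [pow_succ', Perm.mul_apply, Perm.mul_apply, sameCycle_apply_right, sameCycle_apply_right]
      generalize ((P * swap a b) ^ k) a = w at ih ⊢
      rcases eq_or_ne w a with rfl | hxa
      · right; simp [SameCycle.refl]
      rcases eq_or_ne w b with rfl | hxb
      · left; simp [SameCycle.refl]
      · rwa [swap_apply_of_ne_of_ne hxa hxb]
  · rintro (h | h)
    · exact sameCycle_mul_swap_of_not hab h
    · exact hab'.trans (sameCycle_mul_swap_of_not hab h)

theorem orbitFinset_mul_swap_of_not {P : Perm (Fin n)} {a b x : Fin n}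
    (hab : ¬ P.SameCycle a b) (hxa : ¬ P.SameCycle a x) (hxb : ¬ P.SameCycle b x) :
    orbitFinset (P * swap a b) x = orbitFinset P x := by
  have hx : x ∉ orbitFinset (P * swap a b) a := by
    rw [orbitFinset_mul_swap_left hab]
    simp [mem_orbitFinset, hxa, hxb]
  ext y
  simp only [mem_orbitFinset]
  refine ⟨fun h => ?_, sameCycle_mul_swap_of_not hab⟩
  obtain ⟨i, rfl⟩ := h.exists_nat_pow_eq
  clear h
  induction i with
  | zero => exact SameCycle.refl _ _
  | succ k ih =>
    rw [pow_succ', Perm.mul_apply, Perm.mul_apply, sameCycle_apply_right]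
    generalize ((P * swap a b) ^ k) x = w at ih ⊢
    rw [swap_apply_of_ne_of_ne]
    · exact ih
    · rintro rfl; exact hxa ih.symm
    · rintro rfl; exact hxb ih.symm

theorem orbitParts_mul_swap {P : Perm (Fin n)} {a b : Fin n} (hab : ¬ P.SameCycle a b) :
    orbitParts (P * swap a b) = insert (orbitFinset P a ∪ orbitFinset P b)
      (((orbitParts P).erase (orbitFinset P a)).erase (orbitFinset P b)) := by
  have hb : orbitFinset (P * swap a b) b = orbitFinset P a ∪ orbitFinset P b := by
    rw [← orbitFinset_mul_swap_left hab, orbitFinset_eq_iff]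
    exact (sameCycle_mul_swap_self hab).symm
  ext D
  simp only [orbitParts, mem_insert, mem_erase, mem_image, mem_univ, true_and]
  constructor
  · rintro ⟨x, rfl⟩
    by_cases hxa : P.SameCycle a x
    · left
      rw [← orbitFinset_mul_swap_left hab, orbitFinset_eq_iff]
      exact (sameCycle_mul_swap_of_not hab hxa).symm
    by_cases hxb : P.SameCycle b x
    · left
      rw [← hb, orbitFinset_eq_iff]
      exact (sameCycle_mul_swap_of_not hab hxb).symm
    right
    rw [orbitFinset_mul_swap_of_not hab hxa hxb]
    refine ⟨fun h => hxb (orbitFinset_eq_iff.1 h).symm,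
      fun h => hxa (orbitFinset_eq_iff.1 h).symm, x, rfl⟩
  · rintro (rfl | ⟨h1, h2, x, rfl⟩)
    · exact ⟨a, orbitFinset_mul_swap_left hab⟩
    · exact ⟨x, orbitFinset_mul_swap_of_not hab
        (fun h => h2 (orbitFinset_eq_iff.2 h.symm)) (fun h => h1 (orbitFinset_eq_iff.2 h.symm))⟩

theorem union_notMem_orbitParts {P : Perm (Fin n)} {a b : Fin n} (hab : ¬ P.SameCycle a b) :
    orbitFinset P a ∪ orbitFinset P b ∉
      ((orbitParts P).erase (orbitFinset P a)).erase (orbitFinset P b) := by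
  intro h
  obtain ⟨x, -, hx⟩ := mem_image.1 (mem_of_mem_erase (mem_of_mem_erase h))
  have ha : P.SameCycle x a := by
    rw [← mem_orbitFinset, hx]; exact mem_union_left _ (mem_orbitFinset.2 (SameCycle.refl _ _))
  have hb : P.SameCycle x b := by
    rw [← mem_orbitFinset, hx]; exact mem_union_right _ (mem_orbitFinset.2 (SameCycle.refl _ _))
  exact hab (ha.symm.trans hb)

theorem orbitFinset_mem_erase {P : Perm (Fin n)} {a b : Fin n} (hab : ¬ P.SameCycle a b) :
    orbitFinset P b ∈ (orbitParts P).erase (orbitFinset P a) :=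
  mem_erase.2 ⟨fun h => hab (orbitFinset_eq_iff.1 h).symm, orbitFinset_mem_orbitParts P b⟩

theorem card_orbitParts_mul_swap {P : Perm (Fin n)} {a b : Fin n} (hab : ¬ P.SameCycle a b) :
    #(orbitParts (P * swap a b)) + 1 = #(orbitParts P) := by
  rw [orbitParts_mul_swap hab, card_insert_of_notMem (union_notMem_orbitParts hab),
    card_erase_add_one (orbitFinset_mem_erase hab),
    card_erase_add_one (orbitFinset_mem_orbitParts P a)]

theorem prod_orbitParts_mul_swap {P : Perm (Fin n)} {a b : Fin n} (hab : ¬ P.SameCycle a b)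
    (f : Finset (Fin n) → ℝ) :
    (∏ D ∈ orbitParts (P * swap a b), f D) * (f (orbitFinset P a) * f (orbitFinset P b)) =
      f (orbitFinset P a ∪ orbitFinset P b) * ∏ D ∈ orbitParts P, f D := by
  rw [orbitParts_mul_swap hab, prod_insert (union_notMem_orbitParts hab),
    ← mul_prod_erase _ f (orbitFinset_mem_orbitParts P a),
    ← mul_prod_erase _ f (orbitFinset_mem_erase hab)]
  ring

theorem disjoint_orbitFinset {P : Perm (Fin n)} {a b : Fin n} (hab : ¬ P.SameCycle a b) :
    Disjoint (orbitFinset P a) (orbitFinset P b) := by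
  rw [Finset.disjoint_left]
  intro x hxa hxb
  exact hab ((mem_orbitFinset.1 hxa).trans (mem_orbitFinset.1 hxb).symm)

theorem card_orbitParts_le_mul_swap {P : Perm (Fin n)} {a b : Fin n} (hab : P.SameCycle a b) :
    #(orbitParts P) ≤ #(orbitParts (P * swap a b)) := by
  have : orbitParts P = (orbitParts (P * swap a b)).image fun D => D.biUnion (orbitFinset P) := by
    rw [orbitParts, orbitParts, image_image]
    refine image_congr fun x _ => ?_
    ext y
    simp only [Function.comp_apply, mem_biUnion, mem_orbitFinset]
    exact ⟨fun h => ⟨x, SameCycle.refl _ _, h⟩,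
      fun ⟨w, hw, h⟩ => (sameCycle_of_sameCycle_mul_swap hab hw).trans h⟩
  rw [this]
  exact card_image_le

theorem sum_div_sum_orbitFinset (P : Perm (Fin n)) {y : Fin n → ℝ} (hy : ∀ x, 0 < y x) :
    ∑ x, y x / ∑ w ∈ orbitFinset P x, y w = #(orbitParts P) := by
  rw [← sum_fiberwise_of_maps_to (fun x _ => orbitFinset_mem_orbitParts P x),
    card_eq_sum_ones, Nat.cast_sum]
  refine sum_congr rfl fun D hD => ?_
  obtain ⟨c, -, rfl⟩ := mem_image.1 hD
  have hc : univ.filter (fun x => orbitFinset P x = orbitFinset P c) = orbitFinset P c := by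
    ext x
    simp [orbitFinset_eq_iff, mem_orbitFinset, sameCycle_comm]
  rw [sum_congr rfl (g := fun x => y x / ∑ w ∈ orbitFinset P c, y w)
    (fun x hx => by rw [(mem_filter.1 hx).2]), hc, ← sum_div, Nat.cast_one]
  refine div_self (sum_pos (fun i _ => hy i) ⟨c, ?_⟩).ne'
  exact mem_orbitFinset.2 (SameCycle.refl _ _)

theorem orbitParts_one : orbitParts (1 : Perm (Fin n)) = univ.image fun x => {x} := by
  refine image_congr fun x _ => ?_
  ext y
  simp [mem_orbitFinset, eq_comm]

theorem card_orbitParts_eq_one_iff [NeZero n] {P : Perm (Fin n)} :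
    #(orbitParts P) = 1 ↔ ∀ x y, P.SameCycle x y := by
  constructor
  · intro h x y
    rw [← orbitFinset_eq_iff]
    exact card_le_one.1 h.le _ (orbitFinset_mem_orbitParts P x) _ (orbitFinset_mem_orbitParts P y)
  · intro h
    rw [card_eq_one]
    refine ⟨orbitFinset P 0, eq_singleton_iff_unique_mem.2
      ⟨orbitFinset_mem_orbitParts P 0, fun D hD => ?_⟩⟩
    obtain ⟨x, -, rfl⟩ := mem_image.1 hD
    exact orbitFinset_eq_iff.2 (h _ _)

theorem orbitParts_eq_of_card_eq_one [NeZero n] {P : Perm (Fin n)} (h : #(orbitParts P) = 1) :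
    orbitParts P = {univ} := by
  have h' := card_orbitParts_eq_one_iff.1 h
  have : orbitFinset P 0 = univ := by
    ext x; simp [mem_orbitFinset, h' 0 x]
  obtain ⟨D, hD⟩ := card_eq_one.1 h
  have := orbitFinset_mem_orbitParts P 0
  simp_all

theorem sum_sum_not_sameCycle (P : Perm (Fin n)) {y : Fin n → ℝ} (hy : ∀ x, 0 < y x) :
    ∑ a, ∑ b, (if P.SameCycle a b then 0 else y a * y b / ∑ w ∈ orbitFinset P a, y w) =
      (#(orbitParts P) - 1) * ∑ x, y x := by
  have h1 : ∀ a, ∑ b, (if P.SameCycle a b then 0 else y a * y b / ∑ w ∈ orbitFinset P a, y w) =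
      y a / (∑ w ∈ orbitFinset P a, y w) * (∑ x, y x) - y a := by
    intro a
    have hpos : 0 < ∑ w ∈ orbitFinset P a, y w :=
      sum_pos (fun i _ => hy i) ⟨a, mem_orbitFinset.2 (SameCycle.refl _ _)⟩
    rw [← sum_filter_add_sum_filter_not univ (fun x => P.SameCycle a x) y]
    change _ = y a / _ * (∑ w ∈ orbitFinset P a, y w + _) - _
    rw [mul_add, div_mul_cancel₀ _ hpos.ne', add_sub_cancel_left, mul_sum, sum_filter]
    refine sum_congr rfl fun b _ => ?_
    split_ifs <;> first | rfl | ring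
  simp only [h1]
  rw [sum_sub_distrib, ← sum_mul, sum_div_sum_orbitFinset P hy]
  ring

end Orbits

section WalkSum

open Finset Equiv Equiv.Perm

variable {n : ℕ}

theorem sum_lt_add_swap (u : Fin n → Fin n → ℝ) (hu : ∀ a, u a a = 0) :
    ∑ p : Fin n × Fin n with p.1 < p.2, (u p.1 p.2 + u p.2 p.1) = ∑ a, ∑ b, u a b := by
  rw [sum_add_distrib, ← Fintype.sum_prod_type' u,
    ← sum_filter_add_sum_filter_not univ (fun p : Fin n × Fin n => p.1 < p.2)]
  congr 1
  have h : ∑ p : Fin n × Fin n with ¬ p.1 < p.2, u p.1 p.2 =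
      ∑ p : Fin n × Fin n with p.2 < p.1, u p.1 p.2 := by
    symm
    refine sum_subset (fun p hp => ?_) (fun p hp hp' => ?_)
    · simp only [mem_filter, mem_univ, true_and, not_lt] at hp ⊢
      exact hp.le
    · simp only [mem_filter, mem_univ, true_and, not_lt] at hp hp'
      rw [le_antisymm hp' hp, hu]
  rw [h]
  refine sum_equiv (Equiv.prodComm _ _) (fun p => by simp) (fun p _ => by simp)

open Classical in
theorem sum_isSwap (f : Perm (Fin n) → ℝ) :
    ∑ t with t.IsSwap, f t = ∑ p : Fin n × Fin n with p.1 < p.2, f (swap p.1 p.2) := by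
  symm
  refine sum_bij (fun p _ => swap p.1 p.2) (fun p hp => ?_) (fun p hp q hq h => ?_)
    (fun t ht => ?_) (fun _ _ => rfl)
  · simp only [mem_filter, mem_univ, true_and] at hp ⊢
    exact ⟨_, _, hp.ne, rfl⟩
  · simp only [mem_filter, mem_univ, true_and] at hp hq
    obtain ⟨a, b⟩ := p
    obtain ⟨c, d⟩ := q
    dsimp only at *
    have h1 : swap c d a = b := by rw [← h, swap_apply_left]
    rw [swap_apply_def] at h1
    split_ifs at h1 with h2 h3
    · simp [h1, h2]
    · subst h3 h1; exact absurd (hp.trans hq) (lt_irrefl _)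
    · exact absurd h1 hp.ne
  · obtain ⟨a, b, hab, rfl⟩ := (mem_filter.1 ht).2
    rcases lt_or_gt_of_ne hab with h | h
    · exact ⟨(a, b), by simpa using h, rfl⟩
    · exact ⟨(b, a), by simpa using h, swap_comm _ _⟩

open Classical in
/-- The weight of a step `t` at position `x`: zero unless `t` is a transposition, and then `z` or
`1` according to whether `t` moves `x`. -/
noncomputable def swapWeight (z : ℝ) (t : Perm (Fin n)) (x : Fin n) : ℝ :=
  if t.IsSwap then (if t x = x then 1 else z) else 0

/-- The product of the weights of the steps in `F` along the trajectory started at `P o`. -/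
noncomputable def walkWeight (z : ℝ) (o : Fin n) {r : ℕ} (F : Fin r → Perm (Fin n))
    (P : Perm (Fin n)) : ℝ :=
  ∏ k : Fin r, swapWeight z (F k) ((((List.ofFn F).take k).reverse.prod * P) o)

/-- The total weight of the sequences of `r` transpositions turning `P` into a full cycle. -/
noncomputable def walkSum (z : ℝ) (o : Fin n) (r : ℕ) (P : Perm (Fin n)) : ℝ :=
  ∑ F : Fin r → Perm (Fin n),
    if #(orbitParts ((List.ofFn F).reverse.prod * P)) = 1 then walkWeight z o F P else 0

theorem isSwap_conj_iff {t P : Perm (Fin n)} : (P * t * P⁻¹).IsSwap ↔ t.IsSwap := by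
  constructor
  · rintro ⟨a, b, hab, h⟩
    refine ⟨P⁻¹ a, P⁻¹ b, by simpa using hab, ?_⟩
    rw [swap_apply_apply, ← h]
    simp [mul_assoc]
  · rintro ⟨a, b, hab, rfl⟩
    exact ⟨P a, P b, by simpa using hab, (swap_apply_apply P a b).symm⟩

theorem swapWeight_conj (z : ℝ) (t P : Perm (Fin n)) (x : Fin n) :
    swapWeight z (P * t * P⁻¹) (P x) = swapWeight z t x := by
  unfold swapWeight
  by_cases ht : t.IsSwap
  · rw [if_pos ht, if_pos (isSwap_conj_iff.2 ht)]
    simp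
  · rw [if_neg ht, if_neg (mt isSwap_conj_iff.1 ht)]

theorem swapWeight_swap (z : ℝ) (o : Fin n) {a b : Fin n} (hab : a ≠ b) :
    swapWeight z (swap a b) o = (if a = o then z else 1) * (if b = o then z else 1) := by
  have : (swap a b).IsSwap := ⟨a, b, hab, rfl⟩
  rw [swapWeight, if_pos this]
  rcases eq_or_ne o a with rfl | ha
  · simp [hab.symm]
  rcases eq_or_ne o b with rfl | hb
  · simp [hab]
  · simp [swap_apply_of_ne_of_ne ha hb, ha.symm, hb.symm]

theorem walkWeight_cons (z : ℝ) (o : Fin n) {r : ℕ} (t : Perm (Fin n)) (F : Fin r → Perm (Fin n))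
    (P : Perm (Fin n)) :
    walkWeight z o (Fin.cons t F : Fin (r + 1) → Perm (Fin n)) P =
      swapWeight z t (P o) * walkWeight z o F (t * P) := by
  simp [walkWeight, Fin.prod_univ_succ, List.ofFn_succ]

theorem walkSum_zero (z : ℝ) (o : Fin n) (P : Perm (Fin n)) :
    walkSum z o 0 P = if #(orbitParts P) = 1 then 1 else 0 := by
  simp [walkSum, walkWeight]

theorem walkSum_succ' (z : ℝ) (o : Fin n) (r : ℕ) (P : Perm (Fin n)) :
    walkSum z o (r + 1) P = ∑ t, swapWeight z t (P o) * walkSum z o r (t * P) := by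
  rw [walkSum, ← (Fin.consEquiv fun _ => Perm (Fin n)).sum_comp, Fintype.sum_prod_type]
  refine sum_congr rfl fun t _ => ?_
  rw [walkSum, mul_sum]
  refine sum_congr rfl fun F _ => ?_
  simp [Fin.consEquiv, walkWeight_cons, List.ofFn_succ, mul_assoc]

theorem walkSum_succ (z : ℝ) (o : Fin n) (r : ℕ) (P : Perm (Fin n)) :
    walkSum z o (r + 1) P = ∑ p : Fin n × Fin n with p.1 < p.2,
      (if p.1 = o then z else 1) * (if p.2 = o then z else 1) *
        walkSum z o r (P * swap p.1 p.2) := by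
  classical
  rw [walkSum_succ', ← (MulAut.conj P).toEquiv.sum_comp]
  have h : ∀ t, swapWeight z ((MulAut.conj P).toEquiv t) (P o) *
      walkSum z o r ((MulAut.conj P).toEquiv t * P) =
      if t.IsSwap then swapWeight z t o * walkSum z o r (P * t) else 0 := by
    intro t
    simp only [MulEquiv.toEquiv_eq_coe, EquivLike.coe_coe, MulAut.conj_apply, swapWeight_conj,
      inv_mul_cancel_right]
    split_ifs with ht
    · rfl
    · simp [swapWeight, ht]
  simp only [h]
  rw [← sum_filter, sum_isSwap]
  refine sum_congr rfl fun p hp => ?_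
  rw [swapWeight_swap z o (mem_filter.1 hp).2.ne]

theorem walkSum_eq_zero (z : ℝ) (o : Fin n) (r : ℕ) (P : Perm (Fin n))
    (h : r + 1 < #(orbitParts P)) : walkSum z o r P = 0 := by
  induction r generalizing P with
  | zero => rw [walkSum_zero, if_neg (by omega)]
  | succ r ih =>
    rw [walkSum_succ]
    refine sum_eq_zero fun p _ => ?_
    rw [ih, mul_zero]
    by_cases hp : P.SameCycle p.1 p.2
    · have := card_orbitParts_le_mul_swap hp
      omega
    · have := card_orbitParts_mul_swap hp
      omega

theorem sum_mul_walkSum {z : ℝ} (hz : 0 < z) (o : Fin n) (r : ℕ) (P : Perm (Fin n))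
    (h : #(orbitParts P) = r + 1) :
    (∑ x, if x = o then z else 1) * walkSum z o r P =
      r.factorial * (∏ D ∈ orbitParts P, ∑ x ∈ D, if x = o then z else 1) *
        (∑ x, if x = o then z else 1) ^ r := by
  have : NeZero n := ⟨fun h => (h ▸ o).elim0⟩
  set y : Fin n → ℝ := fun x => if x = o then z else 1 with hy
  have hpos : ∀ x, 0 < y x := fun x => by simp only [hy]; split_ifs <;> positivity
  change (∑ x, y x) * _ = _ * (∏ D ∈ orbitParts P, ∑ x ∈ D, y x) * (∑ x, y x) ^ r
  induction r generalizing P with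
  | zero =>
    rw [walkSum_zero, if_pos h, orbitParts_eq_of_card_eq_one h]
    simp
  | succ r ih =>
    set u : Fin n → Fin n → ℝ := fun a b =>
      if P.SameCycle a b then 0 else y a * y b / ∑ w ∈ orbitFinset P a, y w with hu
    have hstep : ∀ a b, y a * y b * ((∑ x, y x) * walkSum z o r (P * swap a b)) =
        r.factorial * (∑ x, y x) ^ r * (∏ D ∈ orbitParts P, ∑ x ∈ D, y x) * (u a b + u b a) := by
      intro a b
      by_cases hab : P.SameCycle a b
      · have := card_orbitParts_le_mul_swap hab
        rw [walkSum_eq_zero _ _ _ _ (by omega)]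
        simp [hu, hab, hab.symm]
      · have hA : 0 < ∑ w ∈ orbitFinset P a, y w :=
          sum_pos (fun i _ => hpos i) ⟨a, mem_orbitFinset.2 (SameCycle.refl _ _)⟩
        have hB : 0 < ∑ w ∈ orbitFinset P b, y w :=
          sum_pos (fun i _ => hpos i) ⟨b, mem_orbitFinset.2 (SameCycle.refl _ _)⟩
        have hc := card_orbitParts_mul_swap hab
        have hp := prod_orbitParts_mul_swap hab (fun D => ∑ x ∈ D, y x)
        rw [sum_union (disjoint_orbitFinset hab)] at hp
        rw [ih _ (by omega)]
        simp only [hu, if_neg hab, if_neg (fun h : P.SameCycle b a => hab h.symm)]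
        field_simp
        linear_combination (y a * y b * (∑ x, y x) ^ r) * hp
    rw [walkSum_succ, mul_sum]
    have hsum : ∑ a, ∑ b, u a b = (r + 1 : ℝ) * ∑ x, y x := by
      rw [sum_sum_not_sameCycle P hpos, h]; push_cast; ring
    calc _ = ∑ p : Fin n × Fin n with p.1 < p.2, r.factorial * (∑ x, y x) ^ r *
          (∏ D ∈ orbitParts P, ∑ x ∈ D, y x) * (u p.1 p.2 + u p.2 p.1) :=
          sum_congr rfl fun p _ => by rw [← hstep]; simp only [hy]; ring
      _ = _ := by
          rw [← mul_sum, sum_lt_add_swap u (fun a => by simp [hu, SameCycle.refl]), hsum,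
            Nat.factorial_succ]
          push_cast
          ring

theorem walkSum_one {m : ℕ} {z : ℝ} (hz : 0 < z) (o : Fin (m + 2)) :
    walkSum z o (m + 1) 1 = (m + 1).factorial * (z * (z + (m + 1)) ^ m) := by
  have hcard : #(orbitParts (1 : Perm (Fin (m + 2)))) = m + 1 + 1 := by
    rw [orbitParts_one, card_image_of_injective _ singleton_injective]; simp
  have hsum : ∑ x : Fin (m + 2), (if x = o then z else 1) = z + (m + 1) := by
    rw [← add_sum_erase _ _ (mem_univ o), if_pos rfl,
      sum_congr rfl (g := fun _ => (1 : ℝ)) (fun x hx => if_neg (ne_of_mem_erase hx))]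
    simp
  have hpos : 0 < z + (m + 1) := by positivity
  have key := sum_mul_walkSum hz o (m + 1) 1 hcard
  rw [hsum, orbitParts_one, prod_image (fun a _ b _ h => singleton_injective h)] at key
  simp only [sum_singleton, prod_ite_eq', mem_univ, if_true] at key
  apply mul_left_cancel₀ hpos.ne'
  rw [key]
  ring

end WalkSum

section FullCycles

open Finset Equiv Equiv.Perm

variable {m : ℕ}

theorem card_orbitParts_eq_one_iff_cycleType {c : Perm (Fin (m + 2))} :
    #(orbitParts c) = 1 ↔ c.cycleType = {m + 2} := by
  rw [card_orbitParts_eq_one_iff]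
  constructor
  · intro h
    have hmove : ∀ x, c x ≠ x := by
      intro x hx
      have h0 := (h x 0).eq_of_left hx
      have h1 := (h x 1).eq_of_left hx
      rw [h0] at h1
      simp at h1
    have hc : c.IsCycle := ⟨0, hmove 0, fun y _ => h 0 y⟩
    have hs : c.support = univ := by ext x; simp [hmove x]
    rw [hc.cycleType, hs]
    simp
  · intro h x y
    have hc : c.IsCycle := card_cycleType_eq_one.1 (by rw [h]; rfl)
    have hs : #c.support = m + 2 := by rw [← sum_cycleType, h]; simp
    have hu : c.support = univ := by rw [← card_eq_iff_eq_univ, hs, Fintype.card_fin]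
    have hmove : ∀ x, c x ≠ x := fun x => by rw [← mem_support, hu]; exact mem_univ x
    exact hc.sameCycle (hmove x) (hmove y)

theorem card_full_cycles :
    #{c : Perm (Fin (m + 2)) | #(orbitParts c) = 1} = (m + 1).factorial := by
  simp only [card_orbitParts_eq_one_iff_cycleType]
  rw [card_of_cycleType_singleton (by omega) (by simp)]
  simp

/-- Any two full cycles are conjugate by a permutation fixing a given point. -/
theorem exists_conj_fixing {c c' : Perm (Fin (m + 2))} (hc : #(orbitParts c) = 1)
    (hc' : #(orbitParts c') = 1) (o : Fin (m + 2)) :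
    ∃ s : Perm (Fin (m + 2)), s o = o ∧ s * c * s⁻¹ = c' := by
  have h : IsConj c c' := isConj_iff_cycleType_eq.2 (by
    rw [card_orbitParts_eq_one_iff_cycleType.1 hc, card_orbitParts_eq_one_iff_cycleType.1 hc'])
  obtain ⟨p, hp⟩ := isConj_iff.1 h
  obtain ⟨i, hi⟩ := card_orbitParts_eq_one_iff.1 hc' (p o) o
  refine ⟨c' ^ i * p, hi, ?_⟩
  calc c' ^ i * p * c * (c' ^ i * p)⁻¹ = c' ^ i * (p * c * p⁻¹) * (c' ^ i)⁻¹ := by group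
    _ = c' := by rw [hp, (Commute.zpow_self c' i).eq, mul_inv_cancel_right]

theorem prod_reverse_map_conj {n : ℕ} (s : Perm (Fin n)) (l : List (Perm (Fin n))) :
    (l.map (MulAut.conj s)).reverse.prod = s * l.reverse.prod * s⁻¹ := by
  rw [← List.map_reverse, ← map_list_prod, MulAut.conj_apply]

theorem walkWeight_conj {n r : ℕ} (z : ℝ) {o : Fin n} {s : Perm (Fin n)} (hs : s o = o)
    (F : Fin r → Perm (Fin n)) :
    walkWeight z o (MulAut.conj s ∘ F) 1 = walkWeight z o F 1 := by
  have hs' : s⁻¹ o = o := by rw [Perm.inv_eq_iff_eq, hs]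
  refine prod_congr rfl fun k _ => ?_
  rw [← List.map_ofFn, ← List.map_take, prod_reverse_map_conj, Function.comp_apply,
    MulAut.conj_apply]
  simp only [mul_one, Perm.mul_apply, hs']
  exact swapWeight_conj z _ _ _

/-- The total weight of the sequences of `m + 1` transpositions with product `c`. -/
noncomputable def cycleSum (z : ℝ) (o : Fin (m + 2)) (c : Perm (Fin (m + 2))) : ℝ :=
  ∑ F : Fin (m + 1) → Perm (Fin (m + 2)) with (List.ofFn F).reverse.prod = c, walkWeight z o F 1

theorem cycleSum_eq_cycleSum (z : ℝ) (o : Fin (m + 2)) {c c' : Perm (Fin (m + 2))}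
    (hc : #(orbitParts c) = 1) (hc' : #(orbitParts c') = 1) :
    cycleSum z o c = cycleSum z o c' := by
  obtain ⟨s, hs, rfl⟩ := exists_conj_fixing hc hc' o
  refine sum_equiv (Equiv.arrowCongr (Equiv.refl _) (MulAut.conj s).toEquiv)
    (fun F => ?_) (fun F _ => (walkWeight_conj z hs F).symm)
  have : (Equiv.arrowCongr (Equiv.refl (Fin (m + 1))) (MulAut.conj s).toEquiv) F =
      MulAut.conj s ∘ F := rfl
  rw [this, mem_filter, mem_filter, ← List.map_ofFn, prod_reverse_map_conj]
  simp

theorem walkSum_eq_factorial_mul_cycleSum (z : ℝ) (o : Fin (m + 2)) :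
    walkSum z o (m + 1) 1 = (m + 1).factorial * cycleSum z o (finRotate (m + 2)) := by
  have hr : #(orbitParts (finRotate (m + 2))) = 1 :=
    card_orbitParts_eq_one_iff_cycleType.2 cycleType_finRotate
  rw [walkSum, ← sum_filter]
  simp only [mul_one]
  rw [← sum_fiberwise_of_maps_to (g := fun F => (List.ofFn F).reverse.prod)
    (t := {c : Perm (Fin (m + 2)) | #(orbitParts c) = 1}) (fun F hF => by simpa using hF),
    ← card_full_cycles, ← nsmul_eq_mul, ← sum_const]
  refine sum_congr rfl fun c hc => ?_
  have hc' := (mem_filter.1 hc).2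
  rw [← cycleSum_eq_cycleSum z o hc' hr, cycleSum, filter_filter]
  refine sum_congr (filter_congr fun F _ => ?_) fun _ _ => rfl
  exact ⟨fun h => h.2, fun h => ⟨h ▸ hc', h⟩⟩

theorem cycleSum_finRotate {z : ℝ} (hz : 0 < z) (o : Fin (m + 2)) :
    cycleSum z o (finRotate (m + 2)) = z * (z + (m + 1)) ^ m := by
  have h := walkSum_one hz o
  rw [walkSum_eq_factorial_mul_cycleSum] at h
  exact mul_left_cancel₀ (by positivity) h

theorem walkWeight_eq_pow_Mcount (z : ℝ) (o : Fin (m + 2))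
    (F : Fin ((m + 2) - 1) → Perm (Fin (m + 2))) (hF : ∀ k, (F k).IsSwap) :
    walkWeight z o F 1 = z ^ Mcount F o := by
  classical
  have h : ∀ k : Fin ((m + 2) - 1),
      swapWeight z (F k) ((((List.ofFn F).take k).reverse.prod * 1) o) =
      if ((List.ofFn F).take k.val).reverse.prod o ≠
        ((List.ofFn F).take (k.val + 1)).reverse.prod o then z else 1 := by
    intro k
    have hk : ((List.ofFn F).take (k.val + 1)).reverse.prod =
        F k * ((List.ofFn F).take k.val).reverse.prod := by
      rw [List.take_succ_eq_append_getElem (by rw [List.length_ofFn]; exact k.2),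
        List.reverse_append, List.prod_append, List.getElem_ofFn, List.reverse_singleton,
        List.prod_singleton]
    rw [hk, swapWeight, if_pos (hF k), mul_one, Perm.mul_apply, ite_not]
    simp only [eq_comm]
  rw [walkWeight, prod_congr rfl (fun k _ => h k), prod_ite]
  rw [prod_const_one, mul_one, prod_const, Mcount]

open Classical in
theorem sum_pow_Mcount {z : ℝ} (hz : 0 < z) (o : Fin (m + 2)) :
    ∑ F : Fin ((m + 2) - 1) → Perm (Fin (m + 2)) with IsMinFact (m + 2) F, z ^ Mcount F o =
      z * (z + (m + 1)) ^ m := by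
  rw [← cycleSum_finRotate hz o, cycleSum]
  refine (sum_congr rfl fun F hF =>
    (walkWeight_eq_pow_Mcount z o F (mem_filter.1 hF).2.1).symm).trans ?_
  refine sum_subset (fun F hF => ?_) (fun F hF hF' => ?_)
  · exact mem_filter.2 ⟨mem_univ _, (mem_filter.1 hF).2.2⟩
  · have h : ¬ ∀ k, (F k).IsSwap := fun h =>
      hF' (mem_filter.2 ⟨mem_univ _, h, (mem_filter.1 hF).2⟩)
    obtain ⟨k, hk⟩ := not_forall.1 h
    exact prod_eq_zero (mem_univ k) (by rw [swapWeight, if_neg hk])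

theorem card_Mcount_eq (o : Fin (m + 2)) (i : ℕ) :
    (Nat.card {F : Fin ((m + 2) - 1) → Perm (Fin (m + 2)) //
      IsMinFact (m + 2) F ∧ Mcount F o = i + 1} : ℝ) = (m + 1 : ℝ) ^ (m - i) * m.choose i := by
  classical
  have hpoly : ∑ F : Fin ((m + 2) - 1) → Perm (Fin (m + 2)) with IsMinFact (m + 2) F,
      (Polynomial.X : Polynomial ℝ) ^ Mcount F o =
      Polynomial.X * (Polynomial.X + Polynomial.C (m + 1 : ℝ)) ^ m := by
    refine Polynomial.eq_of_infinite_eval_eq _ _ ((Set.Ioi_infinite (0 : ℝ)).mono fun z hz => ?_)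
    simpa [Polynomial.eval_finsetSum] using sum_pow_Mcount hz o
  have hcoeff := congrArg (fun p => Polynomial.coeff p (i + 1)) hpoly
  simp only [Polynomial.finsetSum_coeff, Polynomial.coeff_X_pow, Polynomial.coeff_X_mul,
    Polynomial.coeff_X_add_C_pow] at hcoeff
  rw [← hcoeff, Nat.card_eq_fintype_card, Fintype.card_subtype, ← filter_filter,
    ← sum_filter, sum_const, nsmul_one]
  simp only [eq_comm]

end FullCycles

theorem tendsto_choose_mul_pow_div_pow (i : ℕ) :
    Filter.Tendsto (fun m : ℕ => (m + 1 : ℝ) ^ (m - i) * m.choose i / (m + 2 : ℝ) ^ m)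
      Filter.atTop (nhds (Real.exp (-1) / i.factorial)) := by
  have hp : Filter.Tendsto (fun m : ℕ => (m : ℝ) * (1 / (m + 2))) Filter.atTop (nhds 1) := by
    simpa [div_eq_mul_inv] using tendsto_natCast_div_add_atTop (2 : ℝ)
  have h := ProbabilityTheory.tendsto_choose_mul_pow_of_tendsto_mul_atTop i hp
  rw [one_pow, mul_one] at h
  refine h.congr' ?_
  filter_upwards [Filter.eventually_ge_atTop i] with m hm
  have h1 : (1 - 1 / (m + 2) : ℝ) = (m + 1) / (m + 2) := by field_simp; ring
  have h2 : (m + 2 : ℝ) ^ m = (m + 2 : ℝ) ^ i * (m + 2 : ℝ) ^ (m - i) := by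
    rw [← pow_add, Nat.add_sub_cancel' hm]
  rw [h1, h2, div_pow, div_pow, one_pow]
  field_simp

/-- for `j ≥ 1`, the proportion of minimal factorizations of size `n`
with `M_1 = j` tends to `e⁻¹ / (j-1)!` as `n → ∞` (the sequence is indexed by
`n = m + 2` so that it ranges over all sizes `n ≥ 2`; the element `1` of `{1,…,n}`
is the index `0 : Fin n`). -/
theorem limit_M1 (j : ℕ) (hj : 1 ≤ j) :
    Filter.Tendsto (fun m : ℕ =>
      (Nat.card {F : Fin ((m + 2) - 1) → Equiv.Perm (Fin (m + 2)) //
          IsMinFact (m + 2) F ∧ Mcount F ⟨0, by omega⟩ = j} : ℝ) /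
        ((m + 2 : ℝ) ^ ((m + 2) - 2)))
      Filter.atTop (nhds (Real.exp (-1) / (Nat.factorial (j - 1) : ℝ))) := by
  obtain ⟨i, rfl⟩ := Nat.exists_eq_add_of_le' hj
  simp only [card_Mcount_eq, Nat.add_sub_cancel]
  exact tendsto_choose_mul_pow_div_pow i
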